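/- arXiv:2604.07819 — 2 statements merged into one kernel-verified Lean document; each statement's English description precedes it below -/
import Mathlib

section
/- There exists a constant C, depending only on n, α, ε and m, such that for every r > 0 one has ∑_{k=2}^{∞} 2^{kn} ∫_{(2^k r)^α}^{∞} s · ( ∫_{[0,r^α]^m} G_k(u,s) du )² ds ≤ C. -/
open MeasureTheory Set
open scoped ENNReal NNReal

noncomputable section

/-- The auxiliary function `G_k(u, τ)`. -/
def Gfun (n m : ℕ) (α ε r : ℝ) (k : ℕ) (u : Fin m → ℝ) (τ : ℝ) : ℝ :=
  ((∑ i, u i) + τ) ^ (-((m : ℝ) + 1))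
    * max ((r / ((∑ i, u i) + τ) ^ (1 / α)) ^ ((n : ℝ) / 2))
          ((r / ((∑ i, u i) + τ) ^ (1 / α)) ^ (n : ℝ))
    * (1 + ((∑ i, u i) + τ) ^ (1 / α) / ((2 : ℝ) ^ k * r)) ^ ((n : ℝ) / 2)
    * (1 + (2 : ℝ) ^ k * r / ((∑ i, u i) + τ) ^ (1 / α)) ^ (-(n : ℝ) - ε)

lemma rpow_one_div_le_of_rpow_le {α x y : ℝ} (hα : 0 < α) (hx : 0 ≤ x) (h : x ^ α ≤ y) :
    x ≤ y ^ (1 / α) := by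
  calc x = (x ^ α) ^ (1 / α) := by
        rw [← Real.rpow_mul hx, mul_one_div_cancel hα.ne', Real.rpow_one]
    _ ≤ y ^ (1 / α) := Real.rpow_le_rpow (by positivity) h (by positivity)

lemma Gfun_nonneg {n m : ℕ} {α ε r : ℝ} {k : ℕ} {u : Fin m → ℝ} {s : ℝ} (hr : 0 < r)
    (hu : 0 ≤ u) (hs : 0 < s) : 0 ≤ Gfun n m α ε r k u s := by
  have hsum : 0 ≤ ∑ i, u i := Finset.sum_nonneg fun i _ => hu i
  unfold Gfun
  have ht : 0 < (∑ i, u i) + s := by linarith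
  positivity

lemma Gfun_le {n m : ℕ} {α ε r : ℝ} {k : ℕ} {u : Fin m → ℝ} {s : ℝ} (hα : 0 < α) (hε : 0 ≤ ε)
    (hr : 0 < r) (hu : 0 ≤ u) (hs : ((2 : ℝ) ^ k * r) ^ α ≤ s) :
    Gfun n m α ε r k u s ≤ (2 / (2 : ℝ) ^ k) ^ ((n : ℝ) / 2) * s ^ (-((m : ℝ) + 1)) := by
  have hsum : 0 ≤ ∑ i, u i := Finset.sum_nonneg fun i _ => hu i
  have hR : 0 < (2 : ℝ) ^ k * r := by positivity
  have hs0 : 0 < s := (Real.rpow_pos_of_pos hR α).trans_le hs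
  unfold Gfun
  generalize ht : (∑ i, u i) + s = t
  have hst : s ≤ t := by linarith
  have ht0 : 0 < t := hs0.trans_le hst
  have hRT : (2 : ℝ) ^ k * r ≤ t ^ (1 / α) :=
    rpow_one_div_le_of_rpow_le hα hR.le (hs.trans hst)
  generalize t ^ (1 / α) = T at hRT ⊢
  have hT : 0 < T := hR.trans_le hRT
  have hrT : r ≤ T :=
    (le_mul_of_one_le_left hr.le (one_le_pow₀ (by norm_num))).trans hRT
  have h_max : max ((r / T) ^ ((n : ℝ) / 2)) ((r / T) ^ (n : ℝ)) = (r / T) ^ ((n : ℝ) / 2) :=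
    max_eq_left <| Real.rpow_le_rpow_of_exponent_ge (by positivity) ((div_le_one hT).2 hrT)
      (half_le_self n.cast_nonneg)
  have h_growth : (1 + T / ((2 : ℝ) ^ k * r)) ^ ((n : ℝ) / 2)
      ≤ (2 * (T / ((2 : ℝ) ^ k * r))) ^ ((n : ℝ) / 2) := by
    refine Real.rpow_le_rpow (by positivity) ?_ (by positivity)
    linarith [(one_le_div hR).2 hRT]
  have h_decay : (1 + (2 : ℝ) ^ k * r / T) ^ (-(n : ℝ) - ε) ≤ 1 := by
    refine Real.rpow_le_one_of_one_le_of_nonpos ?_ ?_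
    · linarith [div_pos hR hT]
    · linarith [n.cast_nonneg (α := ℝ)]
  have h_first : t ^ (-((m : ℝ) + 1)) ≤ s ^ (-((m : ℝ) + 1)) :=
    Real.rpow_le_rpow_of_nonpos hs0 hst (by linarith [m.cast_nonneg (α := ℝ)])
  rw [h_max]
  calc _ ≤ s ^ (-((m : ℝ) + 1)) * (r / T) ^ ((n : ℝ) / 2)
          * (2 * (T / ((2 : ℝ) ^ k * r))) ^ ((n : ℝ) / 2) * 1 := by gcongr
    _ = (2 / (2 : ℝ) ^ k) ^ ((n : ℝ) / 2) * s ^ (-((m : ℝ) + 1)) := by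
        rw [mul_one, mul_assoc, ← Real.mul_rpow (by positivity) (by positivity), mul_comm]
        congr 2
        field_simp

lemma mul_sq_integral_Gfun_le {n m : ℕ} {α ε r : ℝ} {k : ℕ} {s : ℝ} (hα : 0 < α) (hε : 0 ≤ ε)
    (hr : 0 < r) (hs : ((2 : ℝ) ^ k * r) ^ α ≤ s) :
    s * (∫ u in Icc (0 : Fin m → ℝ) (fun _ => r ^ α), Gfun n m α ε r k u s) ^ 2
      ≤ (2 / (2 : ℝ) ^ k) ^ n * (r ^ α) ^ (2 * m) * s ^ (-(2 * (m : ℝ) + 1)) := by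
  have hs0 : 0 < s := (by positivity : 0 < ((2 : ℝ) ^ k * r) ^ α).trans_le hs
  have h_vol : volume.real (Icc (0 : Fin m → ℝ) (fun _ => r ^ α)) = (r ^ α) ^ m := by
    rw [Measure.real, Real.volume_Icc_pi_toReal (fun _ => by positivity)]
    simp
  have h_int := norm_setIntegral_le_of_norm_le_const (μ := volume)
    (s := Icc (0 : Fin m → ℝ) (fun _ => r ^ α)) (f := fun u => Gfun n m α ε r k u s)
    isCompact_Icc.measure_lt_top (fun u hu => by
      rw [Real.norm_of_nonneg (Gfun_nonneg hr hu.1 hs0)]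
      exact Gfun_le hα hε hr hu.1 hs)
  rw [h_vol, Real.norm_eq_abs] at h_int
  have h_half : ((2 / (2 : ℝ) ^ k) ^ ((n : ℝ) / 2)) ^ 2 = (2 / (2 : ℝ) ^ k) ^ n := by
    rw [← Real.rpow_mul_natCast (by positivity), ← Real.rpow_natCast _ n]
    congr 1
    push_cast
    ring
  have h_pow : s * (s ^ (-((m : ℝ) + 1))) ^ 2 = s ^ (-(2 * (m : ℝ) + 1)) := by
    rw [← Real.rpow_mul_natCast hs0.le, ← Real.rpow_one_add' hs0.le]
    · congr 1
      push_cast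
      ring
    · push_cast
      linarith [m.cast_nonneg (α := ℝ)]
  calc _ ≤ s * ((2 / (2 : ℝ) ^ k) ^ ((n : ℝ) / 2) * s ^ (-((m : ℝ) + 1)) * (r ^ α) ^ m) ^ 2 := by
        refine mul_le_mul_of_nonneg_left ?_ hs0.le
        exact sq_le_sq' (abs_le.1 h_int).1 (abs_le.1 h_int).2
    _ = ((2 / (2 : ℝ) ^ k) ^ ((n : ℝ) / 2)) ^ 2 * (r ^ α) ^ (2 * m)
          * (s * (s ^ (-((m : ℝ) + 1))) ^ 2) := by ring
    _ = _ := by rw [h_half, h_pow]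

lemma lintegral_Gfun_le {n m : ℕ} {α ε r : ℝ} {k : ℕ} (hα : 0 < α) (hε : 0 ≤ ε)
    (hm : 1 ≤ m) (hr : 0 < r) :
    ∫⁻ s in Ioi (((2 : ℝ) ^ k * r) ^ α),
        ENNReal.ofReal (s *
          (∫ u in Icc (0 : Fin m → ℝ) (fun _ => r ^ α), Gfun n m α ε r k u s) ^ 2)
      ≤ ENNReal.ofReal ((2 / (2 : ℝ) ^ k) ^ n * (((2 : ℝ) ^ α)⁻¹ ^ (2 * m)) ^ k) := by
  have hm' : (1 : ℝ) ≤ m := by exact_mod_cast hm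
  have hR : 0 < ((2 : ℝ) ^ k * r) ^ α := by positivity
  have h_exp : -(2 * (m : ℝ) + 1) < -1 := by linarith
  have h_integrable := (integrableOn_Ioi_rpow_of_lt h_exp hR).const_mul
    ((2 / (2 : ℝ) ^ k) ^ n * (r ^ α) ^ (2 * m))
  refine (setLIntegral_mono' measurableSet_Ioi fun s hs =>
    ENNReal.ofReal_le_ofReal (mul_sq_integral_Gfun_le hα hε hr (le_of_lt hs))).trans ?_
  rw [← ofReal_integral_eq_lintegral_ofReal h_integrable]
  swap
  · filter_upwards [ae_restrict_mem measurableSet_Ioi] with s hs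
    have : 0 < s := hR.trans hs
    positivity
  refine ENNReal.ofReal_le_ofReal ?_
  rw [integral_const_mul, integral_Ioi_rpow_of_lt h_exp hR, mul_assoc]
  gcongr
  have h_scale : ((2 : ℝ) ^ k * r) ^ α = ((2 : ℝ) ^ α) ^ k * r ^ α := by
    rw [Real.mul_rpow (by positivity) hr.le, Real.rpow_pow_comm (by norm_num)]
  have h_tail : -(((2 : ℝ) ^ k * r) ^ α) ^ (-(2 * (m : ℝ) + 1) + 1) / (-(2 * (m : ℝ) + 1) + 1)
      = ((((2 : ℝ) ^ α) ^ k * r ^ α) ^ (2 * m))⁻¹ / (2 * m) := by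
    rw [show -(2 * (m : ℝ) + 1) + 1 = -((2 * m : ℕ) : ℝ) by push_cast; ring,
      Real.rpow_neg hR.le, Real.rpow_natCast, neg_div_neg_eq, h_scale]
    push_cast
    rfl
  rw [h_tail]
  calc _ = (((2 : ℝ) ^ α)⁻¹ ^ (2 * m)) ^ k / (2 * m) := by
        have : 0 < r ^ α := by positivity
        rw [mul_pow, mul_inv, ← mul_div_assoc, inv_pow, inv_pow, pow_right_comm]
        field_simp
    _ ≤ _ := div_le_self (by positivity) (by linarith)

theorem statement17 (n : ℕ) (hn : 1 ≤ n) (α ε : ℝ) (hα : 0 < α) (hα2 : α < 2) (hε : 0 < ε)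
    (m : ℕ) (hm : 1 ≤ m) :
    ∃ C : ℝ, 0 < C ∧
      ∀ r : ℝ, 0 < r →
        (∑' k : ℕ, (2 : ℝ≥0∞) ^ ((k + 2) * n) *
            ∫⁻ s in Ioi (((2 : ℝ) ^ (k + 2) * r) ^ α),
              ENNReal.ofReal (s *
                (∫ u in Icc (0 : Fin m → ℝ) (fun _ => r ^ α), Gfun n m α ε r (k + 2) u s) ^ 2))
          ≤ ENNReal.ofReal C := by
  set q : ℝ := ((2 : ℝ) ^ α)⁻¹ ^ (2 * m) with hq
  have hq0 : 0 ≤ q := by positivity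
  have hq1 : q < 1 := by
    refine pow_lt_one₀ (by positivity) ?_ (by omega)
    exact inv_lt_one_of_one_lt₀ (Real.one_lt_rpow (by norm_num) hα)
  refine ⟨2 ^ n * (1 - q)⁻¹, by have := sub_pos.2 hq1; positivity, fun r hr => ?_⟩
  have h_sum : HasSum (fun k : ℕ => (2 : ℝ) ^ n * q ^ k) (2 ^ n * (1 - q)⁻¹) :=
    (hasSum_geometric_of_lt_one hq0 hq1).mul_left _
  rw [← h_sum.tsum_eq, ENNReal.ofReal_tsum_of_nonneg (fun k => by positivity) h_sum.summable]
  refine ENNReal.tsum_le_tsum fun k => ?_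
  calc _ ≤ (2 : ℝ≥0∞) ^ ((k + 2) * n)
          * ENNReal.ofReal ((2 / (2 : ℝ) ^ (k + 2)) ^ n * q ^ (k + 2)) :=
        mul_le_mul_right (lintegral_Gfun_le hα hε.le hm hr) _
    _ = ENNReal.ofReal (2 ^ n * q ^ (k + 2)) := by
        rw [← ENNReal.ofReal_ofNat 2, ← ENNReal.ofReal_pow (by norm_num),
          ← ENNReal.ofReal_mul (by positivity), pow_mul, ← mul_assoc, ← mul_pow]
        congr 3
        field_simp
    _ ≤ ENNReal.ofReal (2 ^ n * q ^ k) := by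
        refine ENNReal.ofReal_le_ofReal ?_
        gcongr ?_ * ?_
        exact pow_le_pow_of_le_one hq0 hq1.le (by omega)
end
end

section
/- There exists a constant C, depending only on n, α, ε and m, such that for every r > 0 one has ∑_{k=2}^{∞} 2^{kn/2} ∫_{(2^k r)^α}^{∞} ∫_{[0,r^α]^m} G_k(u,t) du dt ≤ C. -/
open MeasureTheory Set
open scoped ENNReal NNReal

noncomputable section

/-- Where `|u| + τ` is at least `(2 ^ k * r) ^ α`, the function `Gfun` decays like
`τ ^ (-(m + 1))`, with a gain of `2 ^ (-k n / 2)`. -/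
theorem Gfun_nonneg_and_le {n m : ℕ} {α ε r : ℝ} (hα : 0 < α) (hε : 0 < ε) (hr : 0 < r) (k : ℕ)
    {u : Fin m → ℝ} (hu : 0 ≤ u) {t : ℝ} (ht : ((2 : ℝ) ^ k * r) ^ α < t) :
    0 ≤ Gfun n m α ε r k u t ∧ Gfun n m α ε r k u t ≤
      ((2 : ℝ) / 2 ^ k) ^ ((n : ℝ) / 2) * t ^ (-((m : ℝ) + 1)) := by
  unfold Gfun
  have hR : 0 < (2 : ℝ) ^ k * r := by positivity
  have ht0 : 0 < t := lt_trans (by positivity) ht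
  have hts : t ≤ (∑ i, u i) + t := by
    have : 0 ≤ ∑ i, u i := Finset.sum_nonneg fun i _ => hu i
    linarith
  generalize (∑ i, u i) + t = s at hts
  have hs : 0 < s := ht0.trans_le hts
  have hRx : (2 : ℝ) ^ k * r ≤ s ^ (1 / α) := by
    have := Real.rpow_le_rpow (by positivity) (ht.le.trans hts) (one_div_pos.2 hα).le
    rwa [← Real.rpow_mul hR.le, mul_one_div_cancel hα.ne', Real.rpow_one] at this
  generalize s ^ (1 / α) = x at hRx
  have hx : 0 < x := hR.trans_le hRx
  refine ⟨by positivity, ?_⟩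
  have hrx : r / x ≤ 1 := by
    rw [div_le_one hx]
    refine le_trans ?_ hRx
    exact le_mul_of_one_le_left hr.le (one_le_pow₀ one_le_two)
  have hmax : max ((r / x) ^ ((n : ℝ) / 2)) ((r / x) ^ (n : ℝ)) = (r / x) ^ ((n : ℝ) / 2) := by
    refine max_eq_left (Real.rpow_le_rpow_of_exponent_ge (by positivity) hrx ?_)
    exact half_le_self (Nat.cast_nonneg n)
  have hdecay : s ^ (-((m : ℝ) + 1)) ≤ t ^ (-((m : ℝ) + 1)) :=
    Real.rpow_le_rpow_of_nonpos ht0 hts (by linarith [Nat.cast_nonneg (α := ℝ) m])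
  have hlast : (1 + (2 : ℝ) ^ k * r / x) ^ (-(n : ℝ) - ε) ≤ 1 := by
    refine Real.rpow_le_one_of_one_le_of_nonpos ?_ ?_
    · have : 0 ≤ (2 : ℝ) ^ k * r / x := by positivity
      linarith
    · linarith [Nat.cast_nonneg (α := ℝ) n]
  have hmid : (r / x) ^ ((n : ℝ) / 2) * (1 + x / ((2 : ℝ) ^ k * r)) ^ ((n : ℝ) / 2) ≤
      ((2 : ℝ) / 2 ^ k) ^ ((n : ℝ) / 2) := by
    rw [← Real.mul_rpow (by positivity) (by positivity)]
    refine Real.rpow_le_rpow (by positivity) ?_ (by positivity)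
    have h1 : 1 + x / ((2 : ℝ) ^ k * r) ≤ 2 * (x / ((2 : ℝ) ^ k * r)) := by
      have := (one_le_div hR).2 hRx
      linarith
    calc r / x * (1 + x / ((2 : ℝ) ^ k * r)) ≤ r / x * (2 * (x / ((2 : ℝ) ^ k * r))) := by gcongr
      _ = 2 / 2 ^ k := by field_simp
  rw [hmax]
  calc _ ≤ s ^ (-((m : ℝ) + 1)) * (r / x) ^ ((n : ℝ) / 2)
          * (1 + x / ((2 : ℝ) ^ k * r)) ^ ((n : ℝ) / 2) :=
        mul_le_of_le_one_right (by positivity) hlast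
    _ = ((r / x) ^ ((n : ℝ) / 2) * (1 + x / ((2 : ℝ) ^ k * r)) ^ ((n : ℝ) / 2))
          * s ^ (-((m : ℝ) + 1)) := by ring
    _ ≤ _ := by gcongr

theorem setIntegral_Gfun_le {n m : ℕ} {α ε r : ℝ} (hα : 0 < α) (hε : 0 < ε) (hr : 0 < r) (k : ℕ)
    {t : ℝ} (ht : ((2 : ℝ) ^ k * r) ^ α < t) :
    ∫ u in Icc (0 : Fin m → ℝ) (fun _ => r ^ α), Gfun n m α ε r k u t ≤
      ((2 : ℝ) / 2 ^ k) ^ ((n : ℝ) / 2) * (r ^ α) ^ m * t ^ (-((m : ℝ) + 1)) := by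
  have hvol : volume (Icc (0 : Fin m → ℝ) (fun _ => r ^ α)) = ENNReal.ofReal ((r ^ α) ^ m) := by
    rw [Real.volume_Icc_pi]
    simp [ENNReal.ofReal_pow (Real.rpow_nonneg hr.le α)]
  refine (le_abs_self _).trans ?_
  have h := norm_setIntegral_le_of_norm_le_const (μ := volume)
    (s := Icc (0 : Fin m → ℝ) (fun _ => r ^ α)) (f := fun u => Gfun n m α ε r k u t)
    (C := ((2 : ℝ) / 2 ^ k) ^ ((n : ℝ) / 2) * t ^ (-((m : ℝ) + 1)))
    (by rw [hvol]; exact ENNReal.ofReal_lt_top)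
    (fun u hu => by
      obtain ⟨h0, h1⟩ := Gfun_nonneg_and_le (n := n) hα hε hr k hu.1 ht
      rwa [Real.norm_of_nonneg h0])
  rw [measureReal_def, hvol, ENNReal.toReal_ofReal (by positivity), Real.norm_eq_abs] at h
  exact h.trans_eq (by ring)

theorem lintegral_Ioi_rpow_neg_succ {m : ℕ} (hm : 1 ≤ m) {c T : ℝ} (hc : 0 ≤ c) (hT : 0 < T) :
    ∫⁻ t in Ioi T, ENNReal.ofReal (c * t ^ (-((m : ℝ) + 1))) =
      ENNReal.ofReal (c * (T ^ (-(m : ℝ)) / m)) := by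
  have hm' : (0 : ℝ) < m := by exact_mod_cast hm
  rw [← ofReal_integral_eq_lintegral_ofReal, integral_const_mul,
    integral_Ioi_rpow_of_lt (by linarith) hT]
  · congr 2
    rw [show -((m : ℝ) + 1) + 1 = -m by ring, neg_div_neg_eq]
  · exact (integrableOn_Ioi_rpow_of_lt (by linarith) hT).const_mul c
  · filter_upwards [ae_restrict_mem measurableSet_Ioi] with t ht
    have : 0 < t := hT.trans ht
    positivity

theorem weight_mul_bound_eq (n m k : ℕ) {α r : ℝ} (hr : 0 < r) :
    (2 : ℝ) ^ ((k : ℝ) * n / 2) * (((2 : ℝ) / 2 ^ k) ^ ((n : ℝ) / 2) * (r ^ α) ^ m *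
        ((((2 : ℝ) ^ k * r) ^ α) ^ (-(m : ℝ)) / m)) =
      (2 : ℝ) ^ ((n : ℝ) / 2) / m * ((2 : ℝ) ^ (-(α * m))) ^ k := by
  have h2 : (2 : ℝ) ^ ((k : ℝ) * n / 2) = ((2 : ℝ) ^ k) ^ ((n : ℝ) / 2) := by
    rw [← Real.rpow_natCast 2 k, ← Real.rpow_mul zero_le_two]
    ring_nf
  have h3 : ((2 : ℝ) ^ (-(α * m))) ^ k = (((2 : ℝ) ^ k) ^ α) ^ (-(m : ℝ)) := by
    rw [← Real.rpow_natCast 2 k, ← Real.rpow_natCast _ k, ← Real.rpow_mul zero_le_two,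
      ← Real.rpow_mul zero_le_two, ← Real.rpow_mul zero_le_two]
    ring_nf
  rw [h2, h3, Real.div_rpow zero_le_two (by positivity),
    Real.mul_rpow (by positivity) hr.le, Real.mul_rpow (by positivity) (by positivity),
    Real.rpow_neg (x := r ^ α) (by positivity), Real.rpow_natCast (r ^ α)]
  field_simp

theorem statement19 (n : ℕ) (hn : 1 ≤ n) (α ε : ℝ) (hα : 0 < α) (hα2 : α < 2) (hε : 0 < ε)
    (m : ℕ) (hm : 1 ≤ m) :
    ∃ C : ℝ, 0 < C ∧
      ∀ r : ℝ, 0 < r →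
        (∑' k : ℕ, (2 : ℝ≥0∞) ^ ((((k : ℝ) + 2) * n) / 2) *
            ∫⁻ t in Ioi (((2 : ℝ) ^ (k + 2) * r) ^ α),
              ENNReal.ofReal
                (∫ u in Icc (0 : Fin m → ℝ) (fun _ => r ^ α), Gfun n m α ε r (k + 2) u t))
          ≤ ENNReal.ofReal C := by
  have hm' : (0 : ℝ) < m := by exact_mod_cast hm
  have hq : (2 : ℝ) ^ (-(α * m)) < 1 :=
    Real.rpow_lt_one_of_one_lt_of_neg one_lt_two (neg_lt_zero.2 (by positivity))
  set a : ℕ → ℝ := fun k => (2 : ℝ) ^ ((n : ℝ) / 2) / m * ((2 : ℝ) ^ (-(α * m))) ^ (k + 2)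
  have ha0 : ∀ k, 0 < a k := fun k => by positivity
  have hsum : Summable a :=
    ((summable_nat_add_iff 2).2 (summable_geometric_of_lt_one (by positivity) hq)).mul_left _
  refine ⟨∑' k, a k, hsum.tsum_pos (fun k => (ha0 k).le) 0 (ha0 0), fun r hr => ?_⟩
  rw [ENNReal.ofReal_tsum_of_nonneg (fun k => (ha0 k).le) hsum]
  refine ENNReal.tsum_le_tsum fun k => ?_
  have hw : (2 : ℝ≥0∞) ^ ((((k : ℝ) + 2) * n) / 2) =
      ENNReal.ofReal ((2 : ℝ) ^ (((k + 2 : ℕ) : ℝ) * n / 2)) := by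
    rw [← ENNReal.ofReal_rpow_of_pos two_pos]
    simp
  calc _ ≤ ENNReal.ofReal ((2 : ℝ) ^ (((k + 2 : ℕ) : ℝ) * n / 2)) *
        ∫⁻ t in Ioi (((2 : ℝ) ^ (k + 2) * r) ^ α), ENNReal.ofReal
          (((2 : ℝ) / 2 ^ (k + 2)) ^ ((n : ℝ) / 2) * (r ^ α) ^ m * t ^ (-((m : ℝ) + 1))) := by
        rw [hw]
        refine mul_le_mul' le_rfl (setLIntegral_mono' measurableSet_Ioi fun t ht => ?_)
        exact ENNReal.ofReal_le_ofReal (setIntegral_Gfun_le hα hε hr (k + 2) ht)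
    _ = ENNReal.ofReal (a k) := by
        rw [lintegral_Ioi_rpow_neg_succ hm (by positivity) (by positivity),
          ← ENNReal.ofReal_mul (by positivity), weight_mul_bound_eq n m (k + 2) hr]
end
end
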